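/- Under hypotheses (1)–(3) of the general dissection theorem, the family {f₁,…,f_k} is an inside family for C := closure(D \ (Y ∪ Φ(Y))): fᵢ(C) ⊆ C for every i. -/

import Mathlib

open MeasureTheory

/-- `Φ(X) = ⋃ i, fᵢ(X)`. -/
def PhiMap {d k : ℕ} (f : Fin k → EuclideanSpace ℝ (Fin d) → EuclideanSpace ℝ (Fin d)) :
    Set (EuclideanSpace ℝ (Fin d)) → Set (EuclideanSpace ℝ (Fin d)) :=
  fun X => ⋃ i, f i '' X

theorem LipschitzWith.addHaar_image_eq_zero {E : Type*} [NormedAddCommGroup E] [NormedSpace ℝ E]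
    [FiniteDimensional ℝ E] [MeasurableSpace E] [BorelSpace E] (μ : Measure E)
    [μ.IsAddHaarMeasure] {K : NNReal} {f : E → E} (hf : LipschitzWith K f) {s : Set E}
    (hs : μ s = 0) : μ (f '' s) = 0 := by
  have hs' : Measure.hausdorffMeasure (Module.finrank ℝ E : ℝ) s = 0 :=
    Measure.absolutelyContinuous_isAddHaarMeasure _ μ hs
  refine Measure.absolutelyContinuous_isAddHaarMeasure μ
    (Measure.hausdorffMeasure (Module.finrank ℝ E : ℝ)) (le_antisymm ?_ zero_le)
  simpa [hs'] using hf.hausdorffMeasure_image_le (Nat.cast_nonneg (Module.finrank ℝ E)) s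

/-- Interpolation at `1` of the polynomial `t ↦ det (1 + t A)`. -/
theorem exists_sum_mul_det_one_add_smul_eq (E : Type*) [NormedAddCommGroup E] [NormedSpace ℝ E]
    [FiniteDimensional ℝ E] {v : Fin (Module.finrank ℝ E + 1) → ℝ}
    (hv : Function.Injective v) :
    ∃ c : Fin (Module.finrank ℝ E + 1) → ℝ, ∑ i, c i = 1 ∧
      ∀ A : E →L[ℝ] E, ∑ i, c i * (1 + v i • A).det = (1 + A).det := by
  refine ⟨fun i => (Lagrange.basis Finset.univ v i).eval 1, ?_, fun A => ?_⟩
  · rw [← Polynomial.eval_finsetSum, Lagrange.sum_basis hv.injOn Finset.univ_nonempty,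
      Polynomial.eval_one]
  · let b := Module.finBasis ℝ E
    let M := LinearMap.toMatrix b b (A : E →ₗ[ℝ] E)
    let p : Polynomial ℝ :=
      Matrix.det ((Polynomial.X : Polynomial ℝ) • M.map Polynomial.C +
        (1 : Matrix _ _ ℝ).map Polynomial.C)
    have hp (t : ℝ) : p.eval t = (1 + t • A).det := by
      rw [ContinuousLinearMap.det, ← LinearMap.det_toMatrix b]
      simp only [p, ← Polynomial.coe_evalRingHom, RingHom.map_det]
      congr 1
      ext i j
      by_cases hij : i = j
      · subst hij
        simp [M, LinearMap.toMatrix_apply]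
        ring
      · simp [M, LinearMap.toMatrix_apply, hij]
        ring
    have hdeg : p.degree < (Finset.univ : Finset (Fin (Module.finrank ℝ E + 1))).card := by
      refine lt_of_le_of_lt Polynomial.degree_le_natDegree ?_
      have := Polynomial.natDegree_det_X_add_C_le M 1
      rw [Finset.card_fin]
      simp only [Fintype.card_fin] at this
      exact_mod_cast Nat.lt_succ_of_le this
    have h1 := congrArg (Polynomial.eval 1) (Lagrange.eq_interpolate hv.injOn hdeg)
    rw [Lagrange.interpolate_apply, Polynomial.eval_finsetSum, hp] at h1
    simp only [Polynomial.eval_mul, Polynomial.eval_C, hp, one_smul] at h1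
    rw [h1]
    exact Finset.sum_congr rfl fun i _ => mul_comm _ _

theorem LipschitzWith.bijective_id_add_smul {E : Type*} [NormedAddCommGroup E] [NormedSpace ℝ E]
    [CompleteSpace E] {K : NNReal} {u : E → E} (hu : LipschitzWith K u) {t : ℝ}
    (ht : ‖t‖₊ * K < 1) : Function.Bijective fun x => x + t • u x := by
  have hc (y : E) : ContractingWith (‖t‖₊ * K) fun x => y - t • u x := by
    refine ⟨ht, ?_⟩
    have h := (LipschitzWith.const y).sub ((lipschitzWith_smul t).comp hu)
    rwa [zero_add] at h
  refine ⟨fun a b hab => ?_, fun y => ⟨ContractingWith.fixedPoint _ (hc y), ?_⟩⟩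
  · refine (hc (b + t • u b)).fixedPoint_unique' ?_ ?_
    · exact sub_eq_of_eq_add hab.symm
    · exact add_sub_cancel_right _ _
  · have := (hc y).fixedPoint_isFixedPt
    exact (sub_eq_iff_eq_add.1 this).symm

theorem LipschitzWith.setIntegral_det_one_add_smul_fderiv {E : Type*} [NormedAddCommGroup E]
    [NormedSpace ℝ E] [FiniteDimensional ℝ E] [MeasurableSpace E] [BorelSpace E] (μ : Measure E)
    [μ.IsAddHaarMeasure] {K : NNReal} {u : E → E} (hu : LipschitzWith K u) {s : Set E}
    (hs : MeasurableSet s) (hus : ∀ x ∉ s, u x = 0) {t : ℝ} (ht : ‖t‖₊ * K < 1)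
    (hpos : ∀ x, 0 ≤ (1 + t • fderiv ℝ u x).det) :
    ∫ x in s, (1 + t • fderiv ℝ u x).det ∂μ = μ.real s := by
  set g : E → E := fun x => x + t • u x with hg
  have hbij : Function.Bijective g := hu.bijective_id_add_smul ht
  have hgl : LipschitzWith (1 + ‖t‖₊ * K) g :=
    LipschitzWith.id.add ((lipschitzWith_smul t).comp hu)
  have himg : g '' s = s := by
    have hc : g '' sᶜ = sᶜ := by
      conv_rhs => rw [← Set.image_id sᶜ]
      exact Set.image_congr fun x hx => by simp [hg, hus x hx]
    rw [← compl_inj_iff, ← Set.image_compl_eq hbij, hc]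
  set T := {x | DifferentiableAt ℝ u x}
  have hT : MeasurableSet T := measurableSet_of_differentiableAt ℝ u
  have hT0 : μ Tᶜ = 0 := hu.ae_differentiableAt
  have hae : (s ∩ T : Set E) =ᵐ[μ] s := by
    refine inter_ae_eq_left_of_ae_eq_univ ?_
    rwa [ae_eq_univ]
  have h1 := lintegral_abs_det_fderiv_eq_addHaar_image μ (f := g) (s := s ∩ T)
    (f' := fun x => 1 + t • fderiv ℝ u x) (hs.inter hT)
    (fun x hx => ((hasFDerivAt_id x).add
      ((show DifferentiableAt ℝ u x from hx.2).hasFDerivAt.const_smul t)).hasFDerivWithinAt)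
    hbij.1.injOn
  have h2 : μ (g '' (s ∩ T)) = μ s := by
    refine le_antisymm ((measure_mono (Set.image_mono Set.inter_subset_left)).trans
      (by rw [himg])) ?_
    calc μ s = μ (g '' s) := by rw [himg]
      _ ≤ μ (g '' (s ∩ T) ∪ g '' Tᶜ) := by
        refine measure_mono ?_
        rw [← Set.image_union]
        refine Set.image_mono fun x hx => ?_
        by_cases h : x ∈ T
        · exact Or.inl ⟨hx, h⟩
        · exact Or.inr h
      _ ≤ μ (g '' (s ∩ T)) + μ (g '' Tᶜ) := measure_union_le _ _
      _ = μ (g '' (s ∩ T)) := by rw [hgl.addHaar_image_eq_zero μ hT0, add_zero]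
  rw [h2, Measure.restrict_congr_set hae] at h1
  rw [integral_eq_lintegral_of_nonneg_ae (Filter.Eventually.of_forall hpos)]
  · rw [Measure.real, ← h1]
    congr 1
    exact lintegral_congr fun x => by rw [abs_of_nonneg (hpos x)]
  · refine Measurable.aestronglyMeasurable ?_
    exact ContinuousLinearMap.continuous_det.measurable.comp
      (((measurable_fderiv ℝ u).const_smul t).const_add 1)

theorem LipschitzWith.not_forall_norm_add_eq {E : Type*} [NormedAddCommGroup E]
    [InnerProductSpace ℝ E] [FiniteDimensional ℝ E] {K : NNReal} {u : E → E}
    (hu : LipschitzWith K u) {R : ℝ} (hR : 0 < R) (hu0 : ∀ x, R ≤ ‖x‖ → u x = 0) :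
    ¬ ∀ x, ‖x‖ < R → ‖x + u x‖ = R := by
  intro hsphere
  borelize E
  let μ : Measure E := Measure.addHaar
  have hdet0 : ∀ᵐ x ∂μ, x ∈ Metric.ball (0 : E) R → (1 + fderiv ℝ u x).det = 0 := by
    filter_upwards [hu.ae_differentiableAt] with x hx hxR
    have hw : HasFDerivAt (fun y => y + u y) (1 + fderiv ℝ u x) x :=
      (hasFDerivAt_id x).add hx.hasFDerivAt
    have hconst : (fun y => ‖y + u y‖ ^ 2) =ᶠ[nhds x] fun _ => R ^ 2 := by
      filter_upwards [Metric.isOpen_ball.mem_nhds hxR] with y hy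
      rw [hsphere y (by simpa using hy)]
    have h0 := (hw.norm_sq.unique ((hasFDerivAt_const (R ^ 2) x).congr_of_eventuallyEq hconst))
    by_contra hne
    obtain ⟨z, hz⟩ := (LinearMap.equivOfDetNeZero _ hne).surjective (x + u x)
    have hz' : (1 + fderiv ℝ u x) z = x + u x := hz
    have h1 := congrArg (fun L : E →L[ℝ] ℝ => L z) h0
    simp only [ContinuousLinearMap.comp_apply, smul_apply, hz',
      innerSL_apply_apply, real_inner_self_eq_norm_sq, zero_apply,
      hsphere x (by simpa using hxR)] at h1
    simp [hR.ne'] at h1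
  obtain ⟨ε, hε, hεpos⟩ : ∃ ε > 0, ∀ B : E →L[ℝ] E, ‖B‖ < ε → 0 < (1 + B).det := by
    have hcont : Continuous fun B : E →L[ℝ] E => (1 + B).det :=
      ContinuousLinearMap.continuous_det.comp (continuous_const.add continuous_id)
    have hopen := (isOpen_Ioi (a := (0 : ℝ))).preimage hcont
    have hmem : (0 : E →L[ℝ] E) ∈ (fun B : E →L[ℝ] E => (1 + B).det) ⁻¹' Set.Ioi 0 := by
      simp [ContinuousLinearMap.det]
    obtain ⟨ε, hε, h⟩ := Metric.isOpen_iff.1 hopen _ hmem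
    exact ⟨ε, hε, fun B hB => h (by simpa using hB)⟩
  set δ : ℝ := min 1 ε / (K + 1)
  have hδ : 0 < δ := by positivity
  set v : Fin (Module.finrank ℝ E + 1) → ℝ := fun i => δ / ((i : ℕ) + 1 : ℝ)
  have hv : Function.Injective v := by
    intro i j hij
    have : ((i : ℕ) + 1 : ℝ) = (j : ℕ) + 1 := by
      have := congrArg (fun z => δ / z) hij
      simpa [v, div_div_cancel₀ hδ.ne'] using this
    exact Fin.ext (by exact_mod_cast add_right_cancel this)
  have hvK (i) : |v i| * K < min 1 ε := by
    have hv0 : 0 ≤ v i := by positivity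
    have hvδ : v i ≤ δ := div_le_self hδ.le (by simp)
    rw [abs_of_nonneg hv0]
    calc v i * K ≤ δ * K := by gcongr
      _ < δ * (K + 1) := by gcongr; simp
      _ = min 1 ε := by simp only [δ]; field_simp
  have hvdet (i) (x : E) : 0 ≤ (1 + v i • fderiv ℝ u x).det := by
    refine (hεpos _ ?_).le
    rw [norm_smul, Real.norm_eq_abs]
    calc |v i| * ‖fderiv ℝ u x‖ ≤ |v i| * K := by gcongr; exact norm_fderiv_le_of_lipschitz ℝ hu
      _ < ε := (hvK i).trans_le (min_le_right _ _)
  have hint (i) : ∫ x in Metric.ball 0 R, (1 + v i • fderiv ℝ u x).det ∂μ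
      = μ.real (Metric.ball 0 R) := by
    refine hu.setIntegral_det_one_add_smul_fderiv μ Metric.isOpen_ball.measurableSet
      (fun x hx => hu0 x (by simpa using hx)) ?_ (hvdet i)
    have := (hvK i).trans_le (min_le_left _ _)
    exact_mod_cast this
  have hvol : 0 < μ.real (Metric.ball (0 : E) R) :=
    ENNReal.toReal_pos (Metric.measure_ball_pos μ _ hR).ne' measure_ball_lt_top.ne
  obtain ⟨c, hc1, hc⟩ := exists_sum_mul_det_one_add_smul_eq E hv
  have hzero : ∫ x in Metric.ball 0 R, (1 + fderiv ℝ u x).det ∂μ = 0 := by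
    refine setIntegral_eq_zero_of_ae_eq_zero ?_
    exact hdet0
  rw [integral_congr_ae (.of_forall fun x => (hc (fderiv ℝ u x)).symm)] at hzero
  rw [integral_finsetSum] at hzero
  · simp only [integral_const_mul, hint, ← Finset.sum_mul, hc1, one_mul] at hzero
    exact hvol.ne' hzero
  · intro i _
    refine (Integrable.of_integral_ne_zero ?_).const_mul _
    rw [hint]
    exact hvol.ne'

theorem lipschitzWith_inv_max_norm_smul {E : Type*} [NormedAddCommGroup E] [NormedSpace ℝ E]
    {c : NNReal} (hc : 0 < c) :
    LipschitzWith (2 / c) fun y : E => (max (c : ℝ) ‖y‖)⁻¹ • y := by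
  refine LipschitzWith.of_dist_le_mul fun a b => ?_
  have hc' : (0 : ℝ) < c := hc
  rw [dist_eq_norm, dist_eq_norm]
  set m := max (c : ℝ) ‖a‖
  set n := max (c : ℝ) ‖b‖
  have hm : 0 < m := lt_max_of_lt_left hc'
  have hn : 0 < n := lt_max_of_lt_left hc'
  have hnm : |n - m| ≤ ‖a - b‖ := by
    refine (abs_max_sub_max_le_max _ _ _ _).trans ?_
    rw [norm_sub_rev, sub_self, abs_zero, max_eq_right (abs_nonneg _)]
    exact abs_norm_sub_norm_le b a
  have hdecomp : m⁻¹ • a - n⁻¹ • b = m⁻¹ • ((a - b) + (n - m) • n⁻¹ • b) := by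
    have h : m⁻¹ * ((n - m) * n⁻¹) = m⁻¹ - n⁻¹ := by field_simp
    simp only [smul_add, smul_sub, smul_smul, h, sub_smul]
    abel
  have hb : ‖n⁻¹ • b‖ ≤ 1 := by
    rw [norm_smul, norm_inv, Real.norm_of_nonneg hn.le, inv_mul_le_one₀ hn]
    exact le_max_right _ _
  rw [hdecomp, norm_smul, norm_inv, Real.norm_of_nonneg hm.le]
  calc m⁻¹ * ‖a - b + (n - m) • n⁻¹ • b‖ ≤ (c : ℝ)⁻¹ * (‖a - b‖ + ‖a - b‖ * 1) := by
        gcongr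
        · exact le_max_left _ _
        · refine (norm_add_le _ _).trans ?_
          rw [norm_smul (n - m)]
          gcongr
          exact hnm
    _ = ((2 / c : NNReal) : ℝ) * ‖a - b‖ := by
        push_cast
        ring

/-- The Brouwer fixed point theorem for Lipschitz maps into the unit ball. -/
theorem LipschitzWith.exists_eq_self_of_norm_le_one {E : Type*} [NormedAddCommGroup E]
    [InnerProductSpace ℝ E] [FiniteDimensional ℝ E] {K : NNReal} {k : E → E}
    (hk : LipschitzWith K k) (hk1 : ∀ x, ‖k x‖ ≤ 1) : ∃ x, k x = x := by
  by_contra! hne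
  set χ : E → ℝ := fun x => max 0 (min 1 (2 - ‖x‖))
  have hχ : LipschitzWith 1 χ := by
    have h := (lipschitzWith_one_norm (E := E))
    have h2 : LipschitzWith 1 fun x : E => 2 - ‖x‖ := by
      simpa using (LipschitzWith.const (2 : ℝ)).sub h
    exact (h2.const_min 1).const_max 0
  have hχ0 (x) : 0 ≤ χ x := le_max_left _ _
  have hχ1 (x) : χ x ≤ 1 := max_le zero_le_one (min_le_left _ _)
  have hχk : LipschitzWith (K + 1) fun x => χ x • k x := by
    refine LipschitzWith.of_dist_le_mul fun a b => ?_
    have h1 := hk.dist_le_mul a b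
    have h2 := hχ.dist_le_mul a b
    rw [dist_eq_norm] at *
    have : χ a • k a - χ b • k b = χ a • (k a - k b) + (χ a - χ b) • k b := by
      simp only [smul_sub, sub_smul]; abel
    rw [this]
    refine (norm_add_le _ _).trans ?_
    rw [norm_smul, norm_smul, Real.norm_of_nonneg (hχ0 a)]
    have h3 : χ a * ‖k a - k b‖ ≤ 1 * (K * dist a b) := by gcongr; exact hχ1 a
    have h4 : ‖χ a - χ b‖ * ‖k b‖ ≤ (1 * dist a b) * 1 := by
      gcongr
      · simpa using h2
      · exact hk1 b
    push_cast
    linarith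
  set h : E → E := fun x => x - χ x • k x with hh
  have hhl : LipschitzWith (1 + (K + 1)) h := LipschitzWith.id.sub hχk
  have hout (x : E) (hx : 2 ≤ ‖x‖) : h x = x := by
    have : χ x = 0 := max_eq_left ((min_le_right _ _).trans (by linarith))
    simp [hh, this]
  have hnz (x : E) : h x ≠ 0 := by
    intro h0
    have hx : x = χ x • k x := sub_eq_zero.1 h0
    have hn : ‖x‖ ≤ χ x := by
      conv_lhs => rw [hx]
      rw [norm_smul, Real.norm_of_nonneg (hχ0 x)]
      exact mul_le_of_le_one_right (hχ0 x) (hk1 x)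
    have hχx : χ x = 1 := by
      have hx1 := hn.trans (hχ1 x)
      simp only [χ]
      rw [min_eq_left (by linarith), max_eq_right zero_le_one]
    rw [hχx, one_smul] at hx
    exact hne x hx.symm
  obtain ⟨c, hc, hcle⟩ : ∃ c : NNReal, 0 < c ∧ ∀ x : E, (c : ℝ) ≤ ‖h x‖ := by
    obtain ⟨y, -, hy⟩ := (isCompact_closedBall (0 : E) 2).exists_isMinOn ⟨0, by simp⟩
      hhl.continuous.norm.continuousOn
    refine ⟨min 2 ‖h y‖₊, lt_min two_pos (by simpa using hnz y), fun x => ?_⟩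
    by_cases hx : ‖x‖ ≤ 2
    · exact (min_le_right (2 : ℝ) ‖h y‖).trans (hy (by simpa using hx))
    · rw [hout x (by linarith)]
      exact (min_le_left (2 : ℝ) ‖h y‖).trans (by linarith)
  set u : E → E := fun x =>
    (2 : ℝ) • (max (c : ℝ) ‖h x‖)⁻¹ • h x - (2 : ℝ) • (max ((2 : NNReal) : ℝ) ‖x‖)⁻¹ • x with hu
  have hul := ((lipschitzWith_smul (2 : ℝ)).comp
      ((lipschitzWith_inv_max_norm_smul (E := E) hc).comp hhl)).sub
    ((lipschitzWith_smul (2 : ℝ)).comp (lipschitzWith_inv_max_norm_smul (E := E) two_pos))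
  refine LipschitzWith.not_forall_norm_add_eq (u := u) hul two_pos (fun x hx => ?_) fun x hx => ?_
  · have h1 := hcle x
    simp only [hu]
    rw [max_eq_right h1, hout x hx, max_eq_right (by simpa using hx), sub_self]
  · simp only [hu]
    rw [max_eq_right (hcle x), max_eq_left (by simpa using hx.le)]
    have hp : 0 < ‖h x‖ := norm_pos_iff.2 (hnz x)
    simp [norm_smul, hp.ne']

theorem LipschitzWith.addHaar_image_closedBall_ne_zero {E : Type*} [NormedAddCommGroup E]
    [InnerProductSpace ℝ E] [FiniteDimensional ℝ E] [MeasurableSpace E] [BorelSpace E]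
    (μ : Measure E) [μ.IsAddHaarMeasure] {K : NNReal} {f : E → E} (hf : LipschitzWith K f)
    (hinj : Function.Injective f) : μ (f '' Metric.closedBall 0 1) ≠ 0 := by
  intro hnull
  have hemb : Topology.IsClosedEmbedding fun x : Metric.closedBall (0 : E) 1 => f x :=
    have : CompactSpace (Metric.closedBall (0 : E) 1) :=
      isCompact_iff_compactSpace.1 (isCompact_closedBall 0 1)
    Continuous.isClosedEmbedding (hf.continuous.comp continuous_subtype_val)
      (hinj.comp Subtype.val_injective)
  have : TietzeExtension E := .of_tvs ℝ
  obtain ⟨G, hG⟩ := ContinuousMap.exists_extension hemb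
    (⟨Subtype.val, continuous_subtype_val⟩ : C(Metric.closedBall (0 : E) 1, E))
  have hGf (x : E) (hx : ‖x‖ ≤ 1) : G (f x) = x :=
    congrArg (fun F => F ⟨x, by simpa using hx⟩) hG
  obtain ⟨P, hP, hPG, -⟩ := G.continuous.exists_contDiff_approx 1
    (ε := fun _ => (1 / 2 : ℝ)) continuous_const (fun _ => by norm_num)
  have hPnull : μ (P '' (f '' Metric.closedBall 0 1)) = 0 :=
    addHaar_image_eq_zero_of_differentiableOn_of_addHaar_eq_zero μ
      (hP.differentiable (by simp)).differentiableOn hnull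
  obtain ⟨v, hv, hvP⟩ : ∃ v ∈ Metric.ball (0 : E) (1 / 2),
      v ∉ P '' (f '' Metric.closedBall 0 1) := by
    by_contra! hsub
    exact (Metric.measure_ball_pos μ (0 : E) (by norm_num : (0 : ℝ) < 1 / 2)).ne'
      (measure_mono_null hsub hPnull)
  obtain ⟨M, hM⟩ :=
    ((isCompact_closedBall (0 : E) 1).image hf.continuous).isBounded.subset_closedBall 0
  obtain ⟨L, hL⟩ := (hP.contDiffOn (s := Metric.closedBall 0 M)).exists_lipschitzOnWith (by simp)
    (convex_closedBall 0 M) (isCompact_closedBall 0 M)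
  set r : E → E := fun x => (max ((1 : NNReal) : ℝ) ‖x‖)⁻¹ • x with hr
  have hrl : LipschitzWith (2 / 1) r := lipschitzWith_inv_max_norm_smul one_pos
  have hr1 (x) : ‖r x‖ ≤ 1 := by
    simp only [hr, norm_smul, norm_inv]
    rw [Real.norm_of_nonneg (by positivity), inv_mul_le_one₀ (by positivity)]
    exact le_max_right _ _
  have hPfr := (hL.comp (hf.lipschitzOnWith (s := Metric.closedBall 0 1))
    fun x hx => hM ⟨x, hx, rfl⟩).comp (hrl.lipschitzOnWith (s := Set.univ))
    fun x _ => by simpa using hr1 x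
  rw [lipschitzOnWith_univ] at hPfr
  have hv' : ‖v‖ < 1 / 2 := by simpa using hv
  obtain ⟨x, hx⟩ := ((hrl.sub hPfr).add (LipschitzWith.const v)).exists_eq_self_of_norm_le_one
    fun x => by
      have h1 := hPG (f (r x))
      rw [hGf _ (hr1 x), dist_eq_norm, norm_sub_rev] at h1
      exact (norm_add_le _ _).trans (by simp only [Function.comp_apply]; linarith)
  have hx1 : ‖x‖ ≤ 1 := by
    have h1 := hPG (f (r x))
    rw [hGf _ (hr1 x), dist_eq_norm, norm_sub_rev] at h1
    rw [← hx]
    exact (norm_add_le _ _).trans (by simp only [Function.comp_apply]; linarith)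
  have hrx : r x = x := by
    simp only [hr]
    rw [max_eq_left (by simpa using hx1)]
    simp
  simp only [Function.comp_apply, hrx] at hx
  refine hvP ⟨f x, ⟨x, by simpa using hx1, rfl⟩, ?_⟩
  rw [sub_add_eq_add_sub, sub_eq_iff_eq_add] at hx
  exact (add_left_cancel hx).symm

theorem LipschitzWith.addHaar_image_ne_zero_of_isOpen {E : Type*} [NormedAddCommGroup E]
    [InnerProductSpace ℝ E] [FiniteDimensional ℝ E] [MeasurableSpace E] [BorelSpace E]
    (μ : Measure E) [μ.IsAddHaarMeasure] {K : NNReal} {f : E → E} (hf : LipschitzWith K f)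
    (hinj : Function.Injective f) {U : Set E} (hU : IsOpen U) (hne : U.Nonempty) :
    μ (f '' U) ≠ 0 := by
  obtain ⟨p, hp⟩ := hne
  obtain ⟨ε, hε, hsub⟩ := Metric.nhds_basis_closedBall.mem_iff.1 (hU.mem_nhds hp)
  have hl := hf.comp ((LipschitzWith.const p).add (lipschitzWith_smul (β := E) ε))
  refine fun h0 => hl.addHaar_image_closedBall_ne_zero μ ?_ (measure_mono_null ?_ h0)
  · exact hinj.comp ((add_right_injective p).comp (smul_right_injective E hε.ne'))
  · rintro _ ⟨x, hx, rfl⟩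
    refine ⟨_, hsub ?_, rfl⟩
    have hx1 : ‖x‖ ≤ 1 := by simpa using hx
    simpa [norm_smul, abs_of_pos hε] using mul_le_of_le_one_right hε.le hx1

/-- Under hypotheses (1)–(3) of the general dissection theorem, the family is an
inside family for `C = closure (D \ (Y ∪ Φ(Y)))`. -/
theorem inside_family_for_C {d k : ℕ}
    (D : Set (EuclideanSpace ℝ (Fin d))) (hDc : IsCompact D)
    (hDcl : D = closure (interior D)) (hfr : volume (frontier D) = 0)
    (f : Fin k → EuclideanSpace ℝ (Fin d) → EuclideanSpace ℝ (Fin d))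
    (r : Fin k → NNReal) (hf : ∀ i, ContractingWith (r i) (f i))
    (hinj : ∀ i, Function.Injective (f i))
    (Y : Set (EuclideanSpace ℝ (Fin d))) (hYD : Y ⊆ D)
    (hYcl : Y = closure (interior Y)) (hYfr : volume (frontier Y) = 0)
    (h2sub : ∀ i, f i '' Y ⊆ D)
    (h2Y : ∀ i, volume (Y ∩ f i '' Y) = 0)
    (h2ij : ∀ i j, i ≠ j → volume (f i '' Y ∩ f j '' Y) = 0)
    (h3sub : ∀ i, f i '' (D \ PhiMap f Y) ⊆ D)
    (h3Y : ∀ i, volume (Y ∩ f i '' (D \ PhiMap f Y)) = 0)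
    (h3ij : ∀ i j, i ≠ j →
      volume (f i '' (D \ PhiMap f Y) ∩ f j '' (D \ PhiMap f Y)) = 0) :
    ∀ i, f i '' closure (D \ (Y ∪ PhiMap f Y)) ⊆ closure (D \ (Y ∪ PhiMap f Y)) := by
  have hYcpt : IsCompact Y := hDc.of_isClosed_subset (hYcl ▸ isClosed_closure) hYD
  have hclosed : IsClosed (Y ∪ PhiMap f Y) :=
    (hYcpt.union (isCompact_iUnion fun i => hYcpt.image (hf i).2.continuous)).isClosed
  have hYPhi : volume (Y ∩ PhiMap f Y) = 0 := by
    rw [PhiMap, Set.inter_iUnion]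
    exact measure_iUnion_null h2Y
  intro i
  refine (image_closure_subset_closure_image (hf i).2.continuous).trans
    (closure_minimal ?_ isClosed_closure)
  rintro _ ⟨x, ⟨hxD, hxY⟩, rfl⟩
  rw [mem_closure_iff]
  intro N hN hxN
  set V := f i ⁻¹' N ∩ (Y ∪ PhiMap f Y)ᶜ ∩ interior D
  have hVo : IsOpen V := ((hN.preimage (hf i).2.continuous).inter hclosed.isOpen_compl).inter
    isOpen_interior
  have hVne : V.Nonempty := by
    rw [hDcl] at hxD
    exact mem_closure_iff.1 hxD _ ((hN.preimage (hf i).2.continuous).inter hclosed.isOpen_compl)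
      ⟨hxN, hxY⟩
  have hVD : V ⊆ D \ PhiMap f Y := fun y hy =>
    ⟨interior_subset hy.2, fun h => hy.1.2 (Or.inr h)⟩
  have hVY : volume (f i '' V ∩ Y) = 0 := by
    refine measure_mono_null ?_ (h3Y i)
    rw [Set.inter_comm]
    exact Set.inter_subset_inter_right _ (Set.image_mono hVD)
  have hVj (j) : volume (f i '' V ∩ f j '' Y) = 0 := by
    by_cases hij : i = j
    · subst hij
      rw [← Set.image_inter (hinj i)]
      have : V ∩ Y = ∅ := Set.eq_empty_of_forall_notMem fun y hy => hy.1.1.2 (Or.inl hy.2)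
      simp [this]
    · refine measure_mono_null ?_ (measure_union_null (h3ij i j hij)
        ((hf j).2.addHaar_image_eq_zero volume hYPhi))
      rintro _ ⟨hz, y, hy, rfl⟩
      by_cases hyP : y ∈ PhiMap f Y
      · exact Or.inr ⟨y, ⟨hy, hyP⟩, rfl⟩
      · exact Or.inl ⟨Set.image_mono hVD hz, y, ⟨hYD hy, hyP⟩, rfl⟩
  have hVnull : volume (f i '' V ∩ (Y ∪ PhiMap f Y)) = 0 := by
    rw [Set.inter_union_distrib_left, PhiMap, Set.inter_iUnion]
    exact measure_union_null hVY (measure_iUnion_null hVj)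
  have hVpos := (hf i).2.addHaar_image_ne_zero_of_isOpen volume (hinj i) hVo hVne
  obtain ⟨z, hzV, hz⟩ : ∃ z ∈ f i '' V, z ∉ Y ∪ PhiMap f Y := by
    by_contra! hsub
    rw [Set.inter_eq_left.2 hsub] at hVnull
    exact hVpos hVnull
  refine ⟨z, ?_, h3sub i (Set.image_mono hVD hzV), hz⟩
  obtain ⟨y, hy, rfl⟩ := hzV
  exact hy.1.1
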